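/- arXiv:2307.13245 — 2 statements merged into one kernel-verified Lean document; each statement's English description precedes it below -/
import Mathlib

section
/- Let σ ∈ C¹([0,∞)) be a nonnegative convex function with σ(0) = 0, σ′(0) = 1, and with σ′ concave on [0,∞). Then for all x ≥ 0 and y ≥ 0 one has y·σ′(x) ≤ σ(y) + σ(x). -/
/-- If `σ ∈ C¹([0,∞))` is nonnegative and convex with `σ(0) = 0`, `σ'(0) = 1`,
and `σ'` concave on `[0,∞)`, then `y·σ'(x) ≤ σ(y) + σ(x)` for all `x, y ≥ 0`. -/
theorem stmt1 (σ σ' : ℝ → ℝ)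
    (hσ_deriv : ∀ x ∈ Set.Ici (0:ℝ), HasDerivWithinAt σ (σ' x) (Set.Ici 0) x)
    (hσ'_cont : ContinuousOn σ' (Set.Ici 0))
    (hσ_conv : ConvexOn ℝ (Set.Ici 0) σ)
    (hσ_nonneg : ∀ x : ℝ, 0 ≤ x → 0 ≤ σ x)
    (hσ_zero : σ 0 = 0)
    (hσ'_zero : σ' 0 = 1)
    (hσ'_conc : ConcaveOn ℝ (Set.Ici 0) σ') :
    ∀ x : ℝ, 0 ≤ x → ∀ y : ℝ, 0 ≤ y → y * σ' x ≤ σ y + σ x := by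
  intro x hx y hy
  have tangent : σ x + (y - x) * σ' x ≤ σ y := by
    rcases lt_trichotomy x y with h | h | h
    · have := hσ_conv.le_slope_of_hasDerivWithinAt hx hy h (hσ_deriv x hx)
      rw [slope_def_field, le_div_iff₀ (by linarith)] at this
      linarith
    · subst h; simp
    · have := hσ_conv.slope_le_of_hasDerivWithinAt hy hx h (hσ_deriv x hx)
      rw [slope_def_field, div_le_iff₀ (by linarith)] at this
      linarith
  have trap : x * σ' x ≤ 2 * σ x := by
    rcases hx.eq_or_lt with h | h
    · rw [← h]; simp [hσ_zero]
    set c := (σ' x - 1) / x with hc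
    have hcx : c * x = σ' x - 1 := by rw [hc]; field_simp
    have hd : ∀ t ∈ Set.Icc 0 x, HasDerivWithinAt (fun t => σ t - (t + c / 2 * t ^ 2))
        (σ' t - (1 + c * t)) (Set.Icc 0 x) t := by
      intro t ht
      have h1 := (hσ_deriv t ht.1).mono (fun s (hs : s ∈ Set.Icc 0 x) => Set.mem_Ici.2 hs.1)
      have h2 : HasDerivAt (fun t : ℝ => t + c / 2 * t ^ 2) (1 + c * t) t := by
        have h3 := (hasDerivAt_id' t).add ((hasDerivAt_pow 2 t).const_mul (c / 2))
        refine h3.congr_deriv ?_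
        push_cast
        ring
      exact h1.sub h2.hasDerivWithinAt
    have hm : MonotoneOn (fun t => σ t - (t + c / 2 * t ^ 2)) (Set.Icc 0 x) := by
      apply monotoneOn_of_hasDerivWithinAt_nonneg (convex_Icc 0 x)
        (fun t ht => (hd t ht).continuousWithinAt)
        (fun t ht => (hd t (interior_subset ht)).mono interior_subset)
      intro t ht
      have ht := interior_subset ht
      have hle : t / x ≤ 1 := (div_le_one h).2 ht.2
      have := hσ'_conc.2 (Set.mem_Ici.2 (le_refl (0:ℝ))) (Set.mem_Ici.2 hx)
        (show 0 ≤ 1 - t / x by linarith) (div_nonneg ht.1 hx) (by ring)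
      have e : t / x * x = t := by field_simp
      have e2 : c * t = t / x * (σ' x - 1) := by rw [hc]; ring
      simp only [smul_eq_mul, mul_zero, zero_add, e, hσ'_zero] at this
      linarith
    have := hm (Set.left_mem_Icc.2 hx) (Set.right_mem_Icc.2 hx) hx
    simp only [hσ_zero] at this
    have e3 : c / 2 * x ^ 2 = x * (σ' x - 1) / 2 := by rw [← hcx]; ring
    rw [e3] at this
    linarith
  linarith
end

section
/- Let f^in be a nonnegative function in X_{0,1} and, for each ε ∈ (0,1), let (f_i^ε)_{i≥1} be nonnegative functions on [0,∞) with f_i^ε(0) = f_i^{0,ε} := ε^{-1} ∫_{Λ_i^ε} f^in(x) dx, satisfying Σ_{i≥1} i·f_i^ε(t) ≤ Σ_{i≥1} i·f_i^{0,ε} and Σ_{i≥1} f_i^ε(t) ≤ Σ_{i≥1} f_i^{0,ε} for all t ≥ 0, and set f_ε(x,t) := Σ_{i≥1} f_i^ε(t)·1_{Λ_i^ε}(x). Then: (1) for every t ≥ 0 and ε ∈ (0,1), ∫₀^∞ (1+x) f_ε(x,t) dx ≤ 3‖f^in‖_{0,1}; and (2) for every δ > 0 there exists R_δ > 0 such that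 sup_{ε∈(0,1)} ∫_{R_δ}^∞ f_ε(x,t) dx ≤ δ for every t ≥ 0. -/
open MeasureTheory

/-- The cell `Λ_i^ε = [(i-1/2)ε, (i+1/2)ε)`. -/
noncomputable def cell (ε : ℝ) (i : ℕ) : Set ℝ :=
  Set.Ico (((i : ℝ) - 1/2) * ε) (((i : ℝ) + 1/2) * ε)

/-- The step function `f_ε(x) = Σ_{i≥1} g_i 1_{Λ_i^ε}(x)`. -/
noncomputable def stepFn (ε : ℝ) (g : ℕ → ℝ) (x : ℝ) : ℝ :=
  ∑' i : ℕ, g (i + 1) * (cell ε (i + 1)).indicator (fun _ => (1:ℝ)) x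

theorem cell_meas (ε : ℝ) (i : ℕ) : MeasurableSet (cell ε i) := measurableSet_Ico

theorem cell_pos {ε : ℝ} (h : 0 < ε) (i : ℕ) : cell ε (i+1) ⊆ Set.Ioi 0 := by
  intro x hx
  have h1 := hx.1
  push_cast at h1
  have : (0:ℝ) ≤ i := Nat.cast_nonneg i
  have : 0 < ((i:ℝ) + 1 - 1/2) * ε := mul_pos (by linarith) h
  exact lt_of_lt_of_le this h1

theorem cell_disj {ε : ℝ} (h : 0 < ε) :
    Pairwise (Function.onFun Disjoint (fun i : ℕ => cell ε (i+1))) := by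
  intro i j hij
  rw [Function.onFun, Set.disjoint_left]
  intro x hx hy
  have a1 := hx.1
  have a2 := hx.2
  have b1 := hy.1
  have b2 := hy.2
  have h1 := lt_of_mul_lt_mul_right (a1.trans_lt b2) h.le
  have h2 := lt_of_mul_lt_mul_right (b1.trans_lt a2) h.le
  push_cast at h1 h2
  have h1' : (i:ℝ) < (j:ℝ) + 1 := by linarith
  have h2' : (j:ℝ) < (i:ℝ) + 1 := by linarith
  norm_cast at h1' h2'
  omega

/-- integral of `1 + x` over a cell. -/
theorem cell_int {ε : ℝ} (h : 0 < ε) (i : ℕ) :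
    ∫ x in cell ε i, (1 + x) = ε * (1 + i * ε) := by
  have hle : ((i : ℝ) - 1/2) * ε ≤ ((i : ℝ) + 1/2) * ε :=
    mul_le_mul_of_nonneg_right (by linarith) h.le
  rw [cell, integral_Ico_eq_integral_Ioo, ← integral_Ioc_eq_integral_Ioo,
    ← intervalIntegral.integral_of_le hle,
    intervalIntegral.integral_add (by simp) (by simp), integral_id]
  simp
  ring

theorem cell_integrable (ε : ℝ) (i : ℕ) : IntegrableOn (fun x : ℝ => 1 + x) (cell ε i) := by
  have : IntegrableOn (fun x : ℝ => 1 + x) (Set.Icc (((i : ℝ) - 1/2) * ε) (((i : ℝ) + 1/2) * ε)) :=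
    Continuous.integrableOn_Icc (by fun_prop)
  exact this.mono_set Set.Ico_subset_Icc_self

theorem step_bound {ε : ℝ} (g : ℕ → ℝ) (hg : ∀ i, 0 ≤ g (i+1)) (S : Set ℝ)
    (hS : MeasurableSet S) (w : ℝ → ℝ)
    (hw : ∀ x ∈ S, 0 ≤ w x) (hwi : ∀ i, IntegrableOn w (S ∩ cell ε (i+1)))
    (c : ℕ → ℝ) (hc : ∀ i, ∫ x in S ∩ cell ε (i+1), w x ≤ c i)
    (hs : Summable (fun i => g (i+1) * c i)) :
    ∫ x in S, w x * stepFn ε g x ≤ ∑' i, g (i+1) * c i := by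
  let F : ℕ → ℝ → ℝ := fun i x => g (i+1) * (cell ε (i+1)).indicator w x
  have hFe : ∀ x, w x * stepFn ε g x = ∑' i, F i x := by
    intro x
    rw [stepFn, ← tsum_mul_left]
    congr 1
    ext i
    by_cases hx : x ∈ cell ε (i+1)
    · simp [F, hx]; ring
    · simp [F, hx]
  have hFi : ∀ i, Integrable (F i) (volume.restrict S) := by
    intro i
    refine Integrable.const_mul ?_ _
    rw [integrable_indicator_iff (cell_meas _ _), IntegrableOn, Measure.restrict_restrict (cell_meas _ _),
      Set.inter_comm]
    exact hwi i
  have hFv : ∀ i, ∫ x in S, F i x = g (i+1) * ∫ x in S ∩ cell ε (i+1), w x := by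
    intro i
    simp only [F]
    rw [integral_const_mul, setIntegral_indicator (cell_meas _ _)]
  have hFn : ∀ i, ∫ x in S, ‖F i x‖ = ∫ x in S, F i x := by
    intro i
    refine setIntegral_congr_fun hS ?_
    intro x hx
    refine Real.norm_of_nonneg (mul_nonneg (hg i) ?_)
    by_cases hx' : x ∈ cell ε (i+1)
    · simp [hx', hw x hx]
    · simp [hx']
  have hle : ∀ i, ∫ x in S, F i x ≤ g (i+1) * c i := fun i => by
    rw [hFv]; exact mul_le_mul_of_nonneg_left (hc i) (hg i)
  have h0 : ∀ i, 0 ≤ ∫ x in S, F i x := fun i => by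
    rw [← hFn]; exact integral_nonneg fun _ => norm_nonneg _
  have hsum : Summable (fun i => ∫ x in S, F i x) := Summable.of_nonneg_of_le h0 hle hs
  have key := hasSum_integral_of_summable_integral_norm hFi (by simpa only [hFn] using hsum)
  simp only [hFe]
  rw [← key.tsum_eq]
  exact hsum.tsum_le_tsum hle hs

theorem init_bound (fin : ℝ → ℝ)
    (hfin_nonneg : ∀ x : ℝ, 0 < x → 0 ≤ fin x)
    (hfin_int : IntegrableOn (fun x => (1 + x) * fin x) (Set.Ioi 0)) {ε : ℝ} (h : 0 < ε)
    (hs : Summable (fun i : ℕ => (1 + ((i:ℝ)+1) * ε) * ∫ x in cell ε (i + 1), fin x)) :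
    ∑' i : ℕ, (1 + ((i:ℝ)+1) * ε) * ∫ x in cell ε (i + 1), fin x
      ≤ 3 * ∫ x in Set.Ioi (0:ℝ), (1 + x) * |fin x| := by
  have habs : ∫ x in Set.Ioi (0:ℝ), (1 + x) * |fin x| = ∫ x in Set.Ioi (0:ℝ), (1 + x) * fin x :=
    setIntegral_congr_fun measurableSet_Ioi fun x hx => by
      simp only [abs_of_nonneg (hfin_nonneg x hx)]
  rw [habs, ← integral_const_mul]
  have hfi : IntegrableOn fin (Set.Ioi 0) := by
    have hm : AEStronglyMeasurable fin (volume.restrict (Set.Ioi 0)) := by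
      have h1 : AEStronglyMeasurable (fun x : ℝ => (1 + x)⁻¹ * ((1+x) * fin x))
          (volume.restrict (Set.Ioi 0)) :=
        AEStronglyMeasurable.mul (by
          have : Measurable (fun x : ℝ => (1+x)⁻¹) := by fun_prop
          exact this.aestronglyMeasurable) hfin_int.1
      refine h1.congr ?_
      filter_upwards [ae_restrict_mem measurableSet_Ioi] with x hx
      have : (0:ℝ) < x := hx
      field_simp
    refine Integrable.mono' hfin_int hm ?_
    filter_upwards [ae_restrict_mem measurableSet_Ioi] with x hx
    have hx' : (0:ℝ) < x := hx
    have := hfin_nonneg x hx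
    rw [Real.norm_of_nonneg this]
    nlinarith
  have h3 : IntegrableOn (fun x => 3 * ((1 + x) * fin x)) (Set.Ioi 0) := hfin_int.const_mul 3
  have hsub : (⋃ i : ℕ, cell ε (i+1)) ⊆ Set.Ioi 0 := Set.iUnion_subset (cell_pos h)
  have hU := hasSum_integral_iUnion (fun i => cell_meas ε (i+1)) (cell_disj h) (h3.mono_set hsub)
  have hle : ∀ i : ℕ, (1 + ((i:ℝ)+1) * ε) * ∫ x in cell ε (i + 1), fin x ≤
      ∫ x in cell ε (i+1), 3 * ((1 + x) * fin x) := by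
    intro i
    rw [← integral_const_mul]
    refine setIntegral_mono_on ((hfi.mono_set (cell_pos h i)).const_mul _)
      (h3.mono_set (cell_pos h i)) (cell_meas _ _) ?_
    intro x hx
    have hx0 : (0:ℝ) < x := cell_pos h i hx
    have h1 := hx.1
    push_cast at h1
    rw [← mul_assoc]
    refine mul_le_mul_of_nonneg_right ?_ (hfin_nonneg x hx0)
    have : (0:ℝ) ≤ i * ε := mul_nonneg (Nat.cast_nonneg i) h.le
    nlinarith
  refine (hs.tsum_le_tsum hle hU.summable).trans ?_
  rw [hU.tsum_eq]
  refine setIntegral_mono_set h3 ?_ hsub.eventuallyLE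
  filter_upwards [ae_restrict_mem measurableSet_Ioi] with x hx
  have hx' : (0:ℝ) < x := hx
  have := hfin_nonneg x hx
  simp only [Pi.zero_apply]
  positivity

/-- (1) `∫₀^∞ (1+x) f_ε(x,t) dx ≤ 3‖f^in‖_{0,1}` for all `t ≥ 0` and
`ε ∈ (0,1)`; (2) uniform smallness of the tails: for every `δ > 0` there is `R_δ > 0`
with `∫_{R_δ}^∞ f_ε(x,t) dx ≤ δ` for all `ε ∈ (0,1)` and all `t ≥ 0`. -/
theorem stmt8 (fin : ℝ → ℝ)
    (hfin_nonneg : ∀ x : ℝ, 0 < x → 0 ≤ fin x)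
    (hfin_int : IntegrableOn (fun x => (1 + x) * fin x) (Set.Ioi 0))
    (f : ℝ → ℕ → ℝ → ℝ)
    (hf_nonneg : ∀ ε : ℝ, 0 < ε → ε < 1 → ∀ i : ℕ, 1 ≤ i → ∀ t : ℝ, 0 ≤ t → 0 ≤ f ε i t)
    (hf_init : ∀ ε : ℝ, 0 < ε → ε < 1 → ∀ i : ℕ, 1 ≤ i →
      f ε i 0 = ε⁻¹ * ∫ x in cell ε i, fin x)
    (hf0_sum : ∀ ε : ℝ, 0 < ε → ε < 1 →
      Summable (fun i : ℕ => ((i : ℝ) + 1) * (ε⁻¹ * ∫ x in cell ε (i + 1), fin x)))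
    (hf_sum : ∀ ε : ℝ, 0 < ε → ε < 1 → ∀ t : ℝ, 0 ≤ t →
      Summable (fun i : ℕ => ((i : ℝ) + 1) * f ε (i + 1) t))
    (hmass : ∀ ε : ℝ, 0 < ε → ε < 1 → ∀ t : ℝ, 0 ≤ t →
      ∑' i : ℕ, ((i : ℝ) + 1) * f ε (i + 1) t ≤
        ∑' i : ℕ, ((i : ℝ) + 1) * (ε⁻¹ * ∫ x in cell ε (i + 1), fin x))
    (hnum : ∀ ε : ℝ, 0 < ε → ε < 1 → ∀ t : ℝ, 0 ≤ t →
      ∑' i : ℕ, f ε (i + 1) t ≤ ∑' i : ℕ, (ε⁻¹ * ∫ x in cell ε (i + 1), fin x)) :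
    (∀ t : ℝ, 0 ≤ t → ∀ ε : ℝ, 0 < ε → ε < 1 →
      (∫ x in Set.Ioi (0:ℝ), (1 + x) * stepFn ε (fun i => f ε i t) x) ≤
        3 * ∫ x in Set.Ioi (0:ℝ), (1 + x) * |fin x|) ∧
    (∀ δ : ℝ, 0 < δ → ∃ Rδ : ℝ, 0 < Rδ ∧
      ∀ ε : ℝ, 0 < ε → ε < 1 → ∀ t : ℝ, 0 ≤ t →
        (∫ x in Set.Ioi Rδ, stepFn ε (fun i => f ε i t) x) ≤ δ) := by
  have main : ∀ ε : ℝ, 0 < ε → ε < 1 → ∀ t : ℝ, 0 ≤ t →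
      Summable (fun i : ℕ => f ε (i+1) t * (ε * (1 + ((i:ℝ)+1) * ε))) ∧
      ∑' i : ℕ, f ε (i+1) t * (ε * (1 + ((i:ℝ)+1) * ε)) ≤
        3 * ∫ x in Set.Ioi (0:ℝ), (1 + x) * |fin x| := by
    intro ε h0 h1 t ht
    have red : ∀ a : ℕ → ℝ, (∀ i, 0 ≤ a i) → Summable (fun i : ℕ => ((i:ℝ)+1) * a i) →
        Summable a ∧ HasSum (fun i : ℕ => a i * (ε * (1 + ((i:ℝ)+1) * ε)))
          (ε * ∑' i, a i + ε^2 * ∑' i : ℕ, ((i:ℝ)+1) * a i) := by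
      intro a ha hs
      have hsa : Summable a := Summable.of_nonneg_of_le ha (fun i => by
        have : (0:ℝ) ≤ i := Nat.cast_nonneg i
        nlinarith [ha i, mul_nonneg this (ha i)]) hs
      refine ⟨hsa, ?_⟩
      have e0 : (fun i : ℕ => a i * (ε * (1 + ((i:ℝ)+1) * ε))) =
          fun i : ℕ => ε * a i + ε^2 * (((i:ℝ)+1) * a i) := by
        funext i
        ring
      rw [e0]
      exact (hsa.hasSum.mul_left ε).add (hs.hasSum.mul_left (ε^2))
    have ha0 : ∀ i : ℕ, 0 ≤ ε⁻¹ * ∫ x in cell ε (i + 1), fin x := fun i =>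
      mul_nonneg (inv_nonneg.2 h0.le) (setIntegral_nonneg (cell_meas _ _)
        fun x hx => hfin_nonneg x (cell_pos h0 i hx))
    obtain ⟨-, s1⟩ := red _ (fun i => hf_nonneg ε h0 h1 (i+1) (by omega) t ht) (hf_sum ε h0 h1 t ht)
    obtain ⟨-, s2⟩ := red _ ha0 (hf0_sum ε h0 h1)
    refine ⟨s1.summable, ?_⟩
    have e : ∀ i : ℕ, (ε⁻¹ * ∫ x in cell ε (i + 1), fin x) * (ε * (1 + ((i:ℝ)+1) * ε)) =
        (1 + ((i:ℝ)+1) * ε) * ∫ x in cell ε (i + 1), fin x := fun i => by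
      field_simp
    simp only [e] at s2
    refine le_trans ?_ (init_bound fin hfin_nonneg hfin_int h0 s2.summable)
    rw [s1.tsum_eq, s2.tsum_eq]
    have := hmass ε h0 h1 t ht
    have := hnum ε h0 h1 t ht
    gcongr
  refine ⟨?_, ?_⟩
  · intro t ht ε h0 h1
    obtain ⟨hs, hle⟩ := main ε h0 h1 t ht
    refine le_trans (step_bound (fun i => f ε i t)
      (fun i => hf_nonneg ε h0 h1 (i+1) (by omega) t ht) (Set.Ioi 0) measurableSet_Ioi
      (fun x => 1 + x) ?_ ?_ _ ?_ hs) hle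
    · intro x hx
      have : (0:ℝ) < x := hx
      positivity
    · intro i
      exact (cell_integrable ε (i+1)).mono_set Set.inter_subset_right
    · intro i
      rw [Set.inter_eq_right.2 (cell_pos h0 i), cell_int h0]
      push_cast
      exact le_rfl
  · intro δ hδ
    set N := ∫ x in Set.Ioi (0:ℝ), (1 + x) * |fin x| with hN
    have hN0 : 0 ≤ N := setIntegral_nonneg measurableSet_Ioi fun x hx => by
      have : (0:ℝ) < x := hx
      positivity
    have hR : 0 < 3 * N / δ + 1 := by positivity
    refine ⟨3 * N / δ + 1, hR, ?_⟩
    intro ε h0 h1 t ht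
    obtain ⟨hs, hle⟩ := main ε h0 h1 t ht
    set R := 3 * N / δ + 1 with hRdef
    have hs' := hs.mul_left R⁻¹
    have hb := step_bound (ε := ε) (fun i => f ε i t)
      (fun i => hf_nonneg ε h0 h1 (i+1) (by omega) t ht) (Set.Ioi R) measurableSet_Ioi
      (fun x => 1) (fun _ _ => zero_le_one) (fun i => by
        refine IntegrableOn.mono_set (t := cell ε (i+1)) ?_ Set.inter_subset_right
        simp [cell]) (fun i => R⁻¹ * (ε * (1 + ((i:ℝ)+1) * ε))) (fun i => by
        have e := cell_int h0 (i+1)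
        push_cast at e
        rw [← e, ← integral_const_mul]
        have hI : IntegrableOn (fun x : ℝ => R⁻¹ * (1 + x)) (cell ε (i+1)) :=
          (cell_integrable ε (i+1)).const_mul _
        refine le_trans (setIntegral_mono_on (g := fun x => R⁻¹ * (1 + x)) ?_
          (hI.mono_set Set.inter_subset_right)
          (measurableSet_Ioi.inter (cell_meas _ _)) ?_)
          (setIntegral_mono_set hI ?_ Set.inter_subset_right.eventuallyLE)
        · refine IntegrableOn.mono_set (t := cell ε (i+1)) ?_ Set.inter_subset_right
          simp [cell]
        · intro x hx
          have hx1 : R < x := hx.1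
          rw [inv_mul_eq_div, le_div_iff₀ hR]
          linarith
        · filter_upwards [ae_restrict_mem (cell_meas _ _)] with x hx
          have hx' : (0:ℝ) < x := cell_pos h0 i hx
          simp only [Pi.zero_apply]
          positivity) (by
        refine hs'.congr fun i => ?_
        ring)
    simp only [one_mul] at hb
    refine hb.trans ?_
    have e2 : ∀ i : ℕ, f ε (i+1) t * (R⁻¹ * (ε * (1 + ((i:ℝ)+1) * ε))) =
        R⁻¹ * (f ε (i+1) t * (ε * (1 + ((i:ℝ)+1) * ε))) := fun i => by ring
    simp only [e2]
    rw [tsum_mul_left, inv_mul_le_iff₀ hR]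
    refine hle.trans ?_
    rw [hRdef, add_mul, div_mul_cancel₀ _ hδ.ne']
    linarith
end
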